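/- arXiv:2410.08825 — 2 statements merged into one kernel-verified Lean document; each statement's English description precedes it below -/
import Mathlib

section
/- Let α and β be real numbers with 1/2 ≤ α ≤ 1, α/2 ≤ β ≤ α², and (α,β) ≠ (1,1), and let Δ = (H₂(α) + α·H₂(β/α))/(1+α). Then for all real numbers x and y with 1/2 ≤ x ≤ α, 1/2 ≤ y ≤ α, and x·y ≤ β, one has x·H₂(y) + H₂(x) ≥ Δ·(x+1). -/
/-- Shannon's binary entropy, in base 2. -/
noncomputable def H2 (x : ℝ) : ℝ := -x * Real.logb 2 x - (1 - x) * Real.logb 2 (1 - x)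

lemma H2_eq_binEntropy_div (x : ℝ) : H2 x = Real.binEntropy x / Real.log 2 := by
  rw [H2, Real.binEntropy, Real.logb, Real.logb, Real.log_inv, Real.log_inv]
  ring

lemma concaveOn_H2 : ConcaveOn ℝ (Set.Icc 0 1) H2 := by
  have h := Real.strictConcave_binEntropy.concaveOn.smul
    (inv_nonneg.2 (Real.log_nonneg (one_le_two (α := ℝ))))
  refine h.congr fun x _ => ?_
  rw [H2_eq_binEntropy_div, div_eq_inv_mul, ← smul_eq_mul]

lemma H2_le_one (x : ℝ) : H2 x ≤ 1 := by
  rw [H2_eq_binEntropy_div, div_le_one (Real.log_pos one_lt_two)]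
  exact Real.binEntropy_le_log_two

lemma H2_half : H2 (1/2) = 1 := by
  rw [H2_eq_binEntropy_div, one_div, Real.binEntropy_two_inv,
    div_self (Real.log_pos one_lt_two).ne']

lemma H2_anti {x y : ℝ} (hx : 1/2 ≤ x) (hxy : x ≤ y) (hy : y ≤ 1) : H2 y ≤ H2 x := by
  rw [H2_eq_binEntropy_div, H2_eq_binEntropy_div]
  refine div_le_div_of_nonneg_right ?_ (Real.log_nonneg one_le_two)
  rw [one_div] at hx
  exact Real.binEntropy_strictAntiOn.antitoneOn ⟨hx, hxy.trans hy⟩ ⟨hx.trans hxy, hy⟩ hxy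

theorem entropy_inequality (α β : ℝ)
    (hα₁ : 1/2 ≤ α) (hα₂ : α ≤ 1) (hβ₁ : α/2 ≤ β) (hβ₂ : β ≤ α^2)
    (hne : (α, β) ≠ (1, 1)) :
    ∀ x y : ℝ, 1/2 ≤ x → x ≤ α → 1/2 ≤ y → y ≤ α → x * y ≤ β →
      x * H2 y + H2 x ≥ (H2 α + α * H2 (β / α)) / (1 + α) * (x + 1) := by
  intro x y hx hxα hy hyα hxy
  have hα : 0 < α := by linarith
  obtain ⟨b, rfl⟩ : ∃ b, β = α * b := ⟨β / α, by field_simp⟩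
  rw [mul_div_cancel_left₀ b hα.ne']
  have hb : 1/2 ≤ b := by nlinarith
  have hbα : b ≤ α := by nlinarith
  have hαI : α ∈ Set.Icc (0 : ℝ) 1 := ⟨hα.le, hα₂⟩
  have hbI : b ∈ Set.Icc (0 : ℝ) 1 := ⟨by linarith, by linarith⟩
  have hanti : H2 α ≤ H2 b := H2_anti hb hbα hα₂
  have hb1 := H2_le_one b
  set Δ := (H2 α + α * H2 b) / (1 + α) with hΔ
  have hΔα : Δ * (1 + α) = H2 α + α * H2 b := by rw [hΔ]; field_simp
  have hΔb : Δ * (1 + b) ≤ b * H2 α + H2 b := by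
    rw [hΔ, div_mul_eq_mul_div, div_le_iff₀ (by linarith)]
    have : α * b ≤ 1 := by nlinarith
    nlinarith [mul_nonneg (sub_nonneg.2 this) (sub_nonneg.2 hanti)]
  have hΔhalf : Δ * (3/2) ≤ 1/2 * H2 α + 1 := by
    rw [hΔ, div_mul_eq_mul_div, div_le_iff₀ (by linarith)]
    nlinarith [mul_nonneg (by linarith : 0 ≤ 2 - α) (sub_nonneg.2 (H2_le_one α)),
      mul_nonneg hα.le (sub_nonneg.2 hb1)]
  have hx0 : 0 < x := by linarith
  rcases le_total x b with hxb | hxb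
  · have hHy : x * H2 α ≤ x * H2 y :=
      mul_le_mul_of_nonneg_left (H2_anti hy hyα hα₂) hx0.le
    have hseg : x ∈ segment ℝ (1/2) b := by rw [segment_eq_Icc hb]; exact ⟨hx, hxb⟩
    obtain ⟨s, t, hs, ht, hst, rfl⟩ := hseg
    have hc := concaveOn_H2.2 (by norm_num : (1/2 : ℝ) ∈ Set.Icc 0 1) hbI hs ht hst
    simp only [smul_eq_mul] at *
    rw [H2_half] at hc
    have h₁ := mul_le_mul_of_nonneg_left hΔhalf hs
    have h₂ := mul_le_mul_of_nonneg_left hΔb ht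
    obtain rfl : s = 1 - t := by linarith
    linarith
  · have hyx : y ≤ α * b / x := by rw [le_div_iff₀ hx0]; linarith
    have hxα' : α * b / x ≤ 1 := by rw [div_le_iff₀ hx0]; nlinarith
    have hHy : x * H2 (α * b / x) ≤ x * H2 y :=
      mul_le_mul_of_nonneg_left (H2_anti hy hyx hxα') hx0.le
    have hseg : x ∈ segment ℝ b α := by rw [segment_eq_Icc hbα]; exact ⟨hxb, hxα⟩
    obtain ⟨s, t, hs, ht, hst, hxst⟩ := hseg
    simp only [smul_eq_mul] at hxst
    have hc := concaveOn_H2.2 hbI hαI hs ht hst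
    have hp := concaveOn_H2.2 hαI hbI
      (by positivity : 0 ≤ s * b / x) (by positivity : 0 ≤ t * α / x) (by rw [← add_div, hxst, div_self hx0.ne'])
    simp only [smul_eq_mul] at hc hp
    have hmean : s * b / x * α + t * α / x * b = α * b / x := by
      field_simp
      linear_combination hst
    rw [hxst] at hc
    rw [hmean] at hp
    have hpx := mul_le_mul_of_nonneg_left hp hx0.le
    have hexp : x * (s * b / x * H2 α + t * α / x * H2 b) = s * b * H2 α + t * α * H2 b := by
      field_simp
    have h₁ := mul_le_mul_of_nonneg_left hΔb hs
    have hsum : Δ * (x + 1) = s * (Δ * (1 + b)) + t * (Δ * (1 + α)) := by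
      linear_combination -Δ * hxst - Δ * hst
    rw [hΔα] at hsum
    linarith
end

section
/- Let α_c = 1/√2 and β_c = (√(1+4·α_c) − 1)/2. Every GCB(α_c, β_c)-tree with N ≥ 1 nodes has height h ≤ 1.8798·log₂(N+1). In particular, every such tree with n ≥ 1 nodes has height strictly less than 2·log₂(n+1). -/
/-- Binary trees: `leaf` is the empty tree, `node l r` is a node with subtrees `l` and `r`. -/
inductive BTree : Type
  | leaf : BTree
  | node : BTree → BTree → BTree

namespace BTree

/-- The weight of a binary tree: its number of empty subtrees. -/
def weight : BTree → ℕ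
  | .leaf => 1
  | .node l r => weight l + weight r

/-- The number of nodes of a binary tree. -/
def numNodes : BTree → ℕ
  | .leaf => 0
  | .node l r => numNodes l + numNodes r + 1

/-- The (real-valued) weights of the two child subtrees of a tree; each child subtree of
an empty tree is given weight `1/2`. -/
noncomputable def childWeights : BTree → List ℝ
  | .leaf => [1/2, 1/2]
  | .node l r => [(weight l : ℝ), (weight r : ℝ)]

/-- `IsGCB α β T` : every node `n` of `T` satisfies `|c| ≤ α * |n|` for each of its two child
subtrees `c` and `|g| ≤ β * |n|` for each of its four grandchild subtrees `g`
(child subtrees of an empty child having weight `1/2`). -/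
def IsGCB (α β : ℝ) : BTree → Prop
  | .leaf => True
  | .node l r =>
      (∀ c ∈ childWeights (.node l r), c ≤ α * weight (.node l r)) ∧
      (∀ g ∈ childWeights l ++ childWeights r, g ≤ β * weight (.node l r)) ∧
      IsGCB α β l ∧ IsGCB α β r

/-- Number of levels of a binary tree (empty tree has 0 levels). -/
def levels : BTree → ℕ
  | .leaf => 0
  | .node l r => max (levels l) (levels r) + 1

/-- Height of a binary tree: the maximum depth of a node (root at depth 0).
For a nonempty tree this is `levels - 1`. -/
def height (t : BTree) : ℕ := levels t - 1

/-- External path length: the sum over all empty subtrees of their depths. -/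
def epl : BTree → ℕ
  | .leaf => 0
  | .node l r => epl l + epl r + weight l + weight r

/-- Internal path length: the sum over all nodes of their depths. -/
def ipl : BTree → ℕ
  | .leaf => 0
  | .node l r => ipl l + ipl r + numNodes l + numNodes r

/-- The sum of the weights of all nodes of a binary tree. -/
def weightSum : BTree → ℕ
  | .leaf => 0
  | .node l r => weight (.node l r) + weightSum l + weightSum r

end BTree

namespace BTree

theorem weight_eq_numNodes_add_one (t : BTree) : t.weight = t.numNodes + 1 := by
  induction t with
  | leaf => rfl
  | node l r ihl ihr => simp only [weight, numNodes, ihl, ihr]; omega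

theorem levels_lt_weight (t : BTree) : t.levels < t.weight := by
  induction t with
  | leaf => simp [levels, weight]
  | node l r ihl ihr => simp only [weight, levels]; omega

/-- A tree with at least two levels has a subtree two levels lower whose number of levels is
exactly two less, and the grandchild balance condition bounds its weight. -/
theorem IsGCB.exists_grandchild {α β : ℝ} {t : BTree} (ht : IsGCB α β t) {k : ℕ}
    (hk : t.levels = k + 2) :
    ∃ g : BTree, IsGCB α β g ∧ g.levels = k ∧ (g.weight : ℝ) ≤ β * t.weight := by
  cases t with
  | leaf => simp [levels] at hk
  | node l r =>
    obtain ⟨-, hg, hl, hr⟩ := ht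
    have key : ∀ c : BTree, IsGCB α β c → c.levels = k + 1 →
        (∀ g ∈ childWeights c, g ≤ β * weight (.node l r)) →
        ∃ g : BTree, IsGCB α β g ∧ g.levels = k ∧
          (g.weight : ℝ) ≤ β * weight (.node l r) := by
      intro c hc hck hcg
      cases c with
      | leaf => simp [levels] at hck
      | node a b =>
        obtain ⟨-, -, ha, hb⟩ := hc
        simp only [levels, Nat.add_right_cancel_iff] at hck
        rcases max_choice (levels a) (levels b) with h | h
        · exact ⟨a, ha, h ▸ hck, hcg _ (by simp [childWeights])⟩
        · exact ⟨b, hb, h ▸ hck, hcg _ (by simp [childWeights])⟩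
    have hk' : max (levels l) (levels r) = k + 1 := by
      simp only [levels] at hk; omega
    rcases max_choice (levels l) (levels r) with h | h
    · exact key l hl (h ▸ hk') fun g hgl => hg g (List.mem_append_left _ hgl)
    · exact key r hr (h ▸ hk') fun g hgr => hg g (List.mem_append_right _ hgr)

theorem IsGCB.four_le_weight_sq_mul_pow {α β : ℝ} (hβ : 4 / 9 ≤ β) (k : ℕ) :
    ∀ t : BTree, IsGCB α β t → t.levels = k + 1 → 4 ≤ (t.weight : ℝ) ^ 2 * β ^ k := by
  induction k using Nat.twoStepInduction with
  | zero =>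
    intro t _ hk
    have h : (2 : ℝ) ≤ t.weight := by
      exact_mod_cast (show 2 ≤ t.weight by have := levels_lt_weight t; omega)
    nlinarith
  | one =>
    intro t _ hk
    have h : (3 : ℝ) ≤ t.weight := by
      exact_mod_cast (show 3 ≤ t.weight by have := levels_lt_weight t; omega)
    nlinarith
  | more k ih _ =>
    intro t ht hk
    obtain ⟨g, hg, hgk, hgw⟩ := ht.exists_grandchild (k := k + 1) hk
    have hβ0 : 0 ≤ β := by linarith
    calc (4 : ℝ) ≤ (g.weight : ℝ) ^ 2 * β ^ k := ih g hg hgk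
      _ ≤ (β * t.weight) ^ 2 * β ^ k := by gcongr
      _ = (t.weight : ℝ) ^ 2 * β ^ (k + 2) := by ring

end BTree

theorem critical_beta_bounds :
    4 / 9 ≤ (Real.sqrt (1 + 4 * (1 / Real.sqrt 2)) - 1) / 2 ∧
    (Real.sqrt (1 + 4 * (1 / Real.sqrt 2)) - 1) / 2 ≤ 0.478319 := by
  have hs : 0 < Real.sqrt 2 := by positivity
  have hlo : (0.707 : ℝ) ≤ 1 / Real.sqrt 2 := by
    rw [le_div_iff₀ hs]
    nlinarith [Real.sq_sqrt (show (0 : ℝ) ≤ 2 by norm_num)]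
  have hhi : 1 / Real.sqrt 2 ≤ 0.707107 := by
    rw [div_le_iff₀ hs]
    have : (1.4142135 : ℝ) ≤ Real.sqrt 2 := Real.le_sqrt_of_sq_le (by norm_num)
    linarith
  constructor
  · have : (17 / 9 : ℝ) ≤ Real.sqrt (1 + 4 * (1 / Real.sqrt 2)) :=
      Real.le_sqrt_of_sq_le (by linarith)
    linarith
  · have : Real.sqrt (1 + 4 * (1 / Real.sqrt 2)) ≤ 1.956638 :=
      Real.sqrt_le_iff.mpr ⟨by norm_num, by linarith⟩
    linarith

theorem logb_two_critical_beta_le :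
    Real.logb 2 ((Real.sqrt (1 + 4 * (1 / Real.sqrt 2)) - 1) / 2) ≤ -(183 / 172) := by
  obtain ⟨hlo, hhi⟩ := critical_beta_bounds
  generalize (Real.sqrt (1 + 4 * (1 / Real.sqrt 2)) - 1) / 2 = β at hlo hhi
  have hβ : 0 < β := by linarith
  have hpow : β ^ 172 * 2 ^ 183 ≤ 1 :=
    calc β ^ 172 * 2 ^ 183 ≤ 0.478319 ^ 172 * 2 ^ 183 := by gcongr
      _ ≤ 1 := by norm_num
  have h := Real.logb_le_logb_of_le (b := 2) (by norm_num) (by positivity) hpow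
  rw [Real.logb_mul (by positivity) (by positivity), Real.logb_pow, Real.logb_pow,
    Real.logb_self_eq_one (by norm_num), Real.logb_one] at h
  push_cast at h
  linarith

theorem gcb_critical_height_bound
    (T : BTree)
    (hT : BTree.IsGCB (1 / Real.sqrt 2) ((Real.sqrt (1 + 4 * (1 / Real.sqrt 2)) - 1) / 2) T)
    (hN : 1 ≤ T.numNodes) :
    (T.height : ℝ) ≤ 1.8798 * Real.logb 2 ((T.numNodes : ℝ) + 1) ∧
    (T.height : ℝ) < 2 * Real.logb 2 ((T.numNodes : ℝ) + 1) := by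
  have hlog := logb_two_critical_beta_le
  have hlo := critical_beta_bounds.1
  generalize (Real.sqrt (1 + 4 * (1 / Real.sqrt 2)) - 1) / 2 = β at hT hlog hlo
  have hβ : 0 < β := by linarith
  have hlev : T.levels = T.height + 1 := by
    cases T with
    | leaf => simp [BTree.numNodes] at hN
    | node l r => simp [BTree.height, BTree.levels]
  have hw := hT.four_le_weight_sq_mul_pow hlo _ T hlev
  rw [BTree.weight_eq_numNodes_add_one] at hw
  push_cast at hw
  have hL := Real.logb_le_logb_of_le (b := 2) (by norm_num) (by norm_num) hw
  rw [Real.logb_mul (by positivity) (by positivity), Real.logb_pow, Real.logb_pow,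
    show (4 : ℝ) = 2 ^ 2 by norm_num, Real.logb_pow,
    Real.logb_self_eq_one (by norm_num)] at hL
  push_cast at hL
  have hh : (0 : ℝ) ≤ T.height := Nat.cast_nonneg _
  have := mul_le_mul_of_nonneg_left hlog hh
  constructor <;> linarith
end
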